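/- Let G be a finite cograph and let v ≠ w be vertices of G. Then the collection of strong modules of G containing both v and w has a least element M with respect to inclusion, and v and w are adjacent in G if and only if the subgraph of G induced by M is connected. -/

import Mathlib

/-- A simple graph is `P4`-free if no four (distinct) vertices induce a subgraph
isomorphic to the path on four vertices with three edges. -/
def IsP4Free {V : Type*} (G : SimpleGraph V) : Prop :=
  ¬ ∃ a b c d : V, a ≠ b ∧ a ≠ c ∧ a ≠ d ∧ b ≠ c ∧ b ≠ d ∧ c ≠ d ∧
      G.Adj a b ∧ G.Adj b c ∧ G.Adj c d ∧ ¬ G.Adj a c ∧ ¬ G.Adj a d ∧ ¬ G.Adj b d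

/-- A *module* of a simple graph: a set of vertices whose members all have the same
neighbours outside the set. -/
def IsModule {V : Type*} (G : SimpleGraph V) (M : Set V) : Prop :=
  ∀ v ∈ M, ∀ w ∈ M, ∀ u ∉ M, (G.Adj v u ↔ G.Adj w u)

/-- A module is *strong* if it overlaps no other module: every module is disjoint from it,
contained in it, or contains it. -/
def IsStrongModule {V : Type*} (G : SimpleGraph V) (M : Set V) : Prop :=
  IsModule G M ∧ ∀ M' : Set V, IsModule G M' → M' ∩ M = ∅ ∨ M' ⊆ M ∨ M ⊆ M'

theorem IsP4Free.compl {V : Type*} {G : SimpleGraph V} (h : IsP4Free G) : IsP4Free Gᶜ := by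
  rintro ⟨a, b, c, d, hab, hac, had, hbc, hbd, hcd, h1, h2, h3, h4, h5, h6⟩
  simp only [SimpleGraph.compl_adj, ne_eq, not_and, not_not] at h1 h2 h3 h4 h5 h6
  exact h ⟨b, d, a, c, hbd, hab.symm, hbc, had.symm, hcd.symm, hac, h6 hbd, (h5 had).symm, h4 hac,
    fun e => h1.2 e.symm, h2.2, fun e => h3.2 e.symm⟩

theorem IsModule.compl {V : Type*} {G : SimpleGraph V} {M : Set V} (h : IsModule G M) :
    IsModule Gᶜ M := by
  intro v hv w hw u hu
  have hvu : v ≠ u := ne_of_mem_of_not_mem hv hu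
  have hwu : w ≠ u := ne_of_mem_of_not_mem hw hu
  simp [SimpleGraph.compl_adj, hvu, hwu, h v hv w hw u hu]

theorem isModule_compl_iff {V : Type*} {G : SimpleGraph V} {M : Set V} :
    IsModule Gᶜ M ↔ IsModule G M :=
  ⟨fun h => by simpa using h.compl, IsModule.compl⟩

theorem isStrongModule_compl_iff {V : Type*} {G : SimpleGraph V} {M : Set V} :
    IsStrongModule Gᶜ M ↔ IsStrongModule G M := by
  simp only [IsStrongModule, isModule_compl_iff]

/-- Any intersection of strong modules is strong. -/
theorem IsStrongModule.sInter {V : Type*} {G : SimpleGraph V} {S : Set (Set V)}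
    (hS : ∀ N ∈ S, IsStrongModule G N) : IsStrongModule G (⋂₀ S) := by
  refine ⟨fun v hv w hw u hu => ?_, fun M' hM' => ?_⟩
  · simp only [Set.mem_sInter, not_forall] at hu
    obtain ⟨N, hN, huN⟩ := hu
    exact (hS N hN).1 v (hv N hN) w (hw N hN) u huN
  · by_contra! hcon
    obtain ⟨⟨x, hxM', hx⟩, hsub, hsup⟩ := hcon
    obtain ⟨y, hyM', hy⟩ := Set.not_subset.1 hsub
    simp only [Set.mem_sInter, not_forall] at hy
    obtain ⟨N, hN, hyN⟩ := hy
    rcases (hS N hN).2 M' hM' with h | h | h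
    · exact Set.notMem_empty x (h ▸ ⟨hxM', hx N hN⟩)
    · exact hyN (h hyM')
    · exact hsup ((Set.sInter_subset_of_mem hN).trans h)

/-- The vertices reachable from `v` inside the set `M`. -/
def componentIn {V : Type*} (G : SimpleGraph V) (M : Set V) (v : M) : Set V :=
  {x | ∃ hx : x ∈ M, (G.induce M).Reachable v ⟨x, hx⟩}

theorem componentIn_subset {V : Type*} (G : SimpleGraph V) (M : Set V) (v : M) :
    componentIn G M v ⊆ M :=
  fun _ hx => hx.1

theorem mem_componentIn_of_adj {V : Type*} {G : SimpleGraph V} {M : Set V} {v : M} {x y : V}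
    (hx : x ∈ componentIn G M v) (hy : y ∈ M) (h : G.Adj x y) : y ∈ componentIn G M v := by
  obtain ⟨hxM, hr⟩ := hx
  have hadj : (G.induce M).Adj ⟨x, hxM⟩ ⟨y, hy⟩ := h
  exact ⟨hy, hr.trans hadj.reachable⟩

/-- The connected components of a strong module are strong modules. -/
theorem IsStrongModule.componentIn {V : Type*} {G : SimpleGraph V} {M : Set V}
    (hM : IsStrongModule G M) (v : M) : IsStrongModule G (componentIn G M v) := by
  refine ⟨fun x hx y hy u hu => ?_, fun M' hM' => ?_⟩
  · by_cases huM : u ∈ M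
    · exact iff_of_false (fun h => hu (mem_componentIn_of_adj hx huM h))
        (fun h => hu (mem_componentIn_of_adj hy huM h))
    · exact hM.1 x hx.1 y hy.1 u huM
  · by_contra! hcon
    obtain ⟨⟨x, hxM', hx⟩, hsub, hsup⟩ := hcon
    have hM'M : M' ⊆ M := by
      rcases hM.2 M' hM' with h | h | h
      · exact absurd (show x ∈ (∅ : Set V) from h ▸ ⟨hxM', hx.1⟩) (Set.notMem_empty x)
      · exact h
      · exact absurd ((componentIn_subset G M v).trans h) hsup
    obtain ⟨y, hyM', hy⟩ := Set.not_subset.1 hsub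
    obtain ⟨z, hz, hzM'⟩ := Set.not_subset.1 hsup
    obtain ⟨hxM, hvx⟩ := hx
    obtain ⟨hzM, hvz⟩ := hz
    obtain ⟨p⟩ := hvx.symm.trans hvz
    obtain ⟨d, hd, hd1, hd2⟩ := p.exists_boundary_dart {a | (a : V) ∈ M'} hxM' hzM'
    have hadj : G.Adj d.fst d.snd := d.adj
    have hdC : (d.snd : V) ∈ _root_.componentIn G M v := by
      refine ⟨d.snd.2, hvx.trans ?_⟩
      classical exact ⟨p.takeUntil _ (p.dart_snd_mem_support_of_mem_darts hd)⟩
    exact hy (mem_componentIn_of_adj hdC (hM'M hyM') ((hM' _ hd1 y hyM' _ hd2).1 hadj).symm)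

theorem induce_connected_of_subset_componentIn {V : Type*} {G : SimpleGraph V} {M : Set V}
    (v : M) (h : M ⊆ componentIn G M v) : (G.induce M).Connected := by
  rw [SimpleGraph.connected_iff_exists_forall_reachable]
  exact ⟨v, fun x => (h x.2).2⟩

/-- A strong module that is least among those containing two adjacent vertices is connected. -/
theorem induce_connected_of_least_of_adj {V : Type*} {G : SimpleGraph V} {M : Set V} {v w : V}
    (hM : IsStrongModule G M) (hv : v ∈ M) (hw : w ∈ M)
    (hleast : ∀ M' : Set V, IsStrongModule G M' → v ∈ M' → w ∈ M' → M ⊆ M')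
    (h : G.Adj v w) : (G.induce M).Connected := by
  have hvC : v ∈ componentIn G M ⟨v, hv⟩ := ⟨hv, .rfl⟩
  exact induce_connected_of_subset_componentIn ⟨v, hv⟩
    (hleast _ (hM.componentIn ⟨v, hv⟩) hvC (mem_componentIn_of_adj hvC hw h))

/-- `S` splits into two nonempty parts with no edge of `G` between them. -/
def HasCut {V : Type*} (G : SimpleGraph V) (S : Set V) : Prop :=
  ∃ A B : Set V, A.Nonempty ∧ B.Nonempty ∧ A ∪ B = S ∧ ∀ a ∈ A, ∀ b ∈ B, a ≠ b ∧ ¬ G.Adj a b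

theorem HasCut.not_connected {V : Type*} {G : SimpleGraph V} {S : Set V} (h : HasCut G S) :
    ¬ (G.induce S).Connected := by
  obtain ⟨A, B, ⟨a, ha⟩, ⟨b, hb⟩, rfl, hAB⟩ := h
  intro hc
  obtain ⟨p⟩ := hc.preconnected ⟨a, Or.inl ha⟩ ⟨b, Or.inr hb⟩
  obtain ⟨d, -, hd1, hd2⟩ :=
    p.exists_boundary_dart {x | (x : V) ∈ A} ha (fun h => (hAB b h b hb).1 rfl)
  exact (hAB _ hd1 _ (d.snd.2.resolve_left hd2)).2 d.adj

theorem HasCut.insert_or_compl {V : Type*} {G : SimpleGraph V} (hG : IsP4Free G) {S : Set V} {x : V}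
    (hx : x ∉ S) (h : HasCut G S) : HasCut G (insert x S) ∨ HasCut Gᶜ (insert x S) := by
  obtain ⟨A, B, hA, hB, rfl, hAB⟩ := h
  by_cases hall : ∀ y ∈ A ∪ B, G.Adj x y
  · refine Or.inr ⟨{x}, A ∪ B, Set.singleton_nonempty x, hA.inl, rfl, ?_⟩
    rintro _ rfl y hy
    exact ⟨(hall y hy).ne, fun h => (SimpleGraph.compl_adj _ _ _ |>.1 h).2 (hall y hy)⟩
  refine Or.inl ?_
  push Not at hall
  obtain ⟨y, hy, hxy⟩ := hall
  wlog hyA : y ∈ A generalizing A B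
  · rw [Set.union_comm]
    rw [Set.union_comm] at hx hy
    exact this B A hB hA (fun b hb a ha => ⟨(hAB a ha b hb).1.symm,
      fun h => (hAB a ha b hb).2 h.symm⟩) hx hy (hy.resolve_right hyA)
  by_cases hxB : ∃ b ∈ B, G.Adj x b
  · obtain ⟨b, hb, hxb⟩ := hxB
    refine ⟨{a ∈ A | ¬ G.Adj x a}, insert x ({a ∈ A | G.Adj x a} ∪ B), ⟨y, hyA, hxy⟩,
      Set.insert_nonempty _ _, ?_, ?_⟩
    · ext z
      simp only [Set.mem_union, Set.mem_insert_iff, Set.mem_ofPred_eq]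
      tauto
    · rintro a ⟨ha, hxa⟩ c (rfl | ⟨hc, hxc⟩ | hc)
      · exact ⟨fun e => hx (Or.inl (e ▸ ha)), fun h => hxa h.symm⟩
      · refine ⟨fun e => hxa (e ▸ hxc), fun hac => hG ⟨a, c, x, b, hac.ne, ?_, (hAB a ha b hb).1,
          hxc.ne.symm, (hAB c hc b hb).1, hxb.ne, hac, hxc.symm, hxb, fun h => hxa h.symm,
          (hAB a ha b hb).2, (hAB c hc b hb).2⟩⟩
        exact fun e => hx (Or.inl (e ▸ ha))
      · exact hAB a ha c hc
  · push Not at hxB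
    refine ⟨insert x A, B, Set.insert_nonempty _ _, hB, Set.insert_union, ?_⟩
    rintro a (rfl | ha) b hb
    · exact ⟨fun e => hx (Or.inr (e ▸ hb)), hxB b hb⟩
    · exact hAB a ha b hb

/-- Every finite set of at least two vertices of a cograph is disconnected in the graph or in
its complement. -/
theorem IsP4Free.hasCut_or_hasCut_compl {V : Type*} {G : SimpleGraph V} (hG : IsP4Free G)
    {S : Set V} (hS : S.Finite) (hS' : S.Nontrivial) : HasCut G S ∨ HasCut Gᶜ S := by
  induction S, hS using Set.Finite.induction_on with
  | empty => exact absurd hS' Set.not_nontrivial_empty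
  | @insert x S hx _ ih =>
    rcases S.subsingleton_or_nontrivial with hsub | hnt
    · rcases hsub.eq_empty_or_singleton with rfl | ⟨y, rfl⟩
      · simp at hS'
      · have hxy : x ≠ y := hx
        by_cases hadj : G.Adj x y
        · refine Or.inr ⟨{x}, {y}, by simp, by simp, rfl, ?_⟩
          simp [hxy, hadj]
        · refine Or.inl ⟨{x}, {y}, by simp, by simp, rfl, ?_⟩
          simp [hxy, hadj]
    · rcases ih hnt with h | h
      · exact h.insert_or_compl hG hx
      · simpa [or_comm] using h.insert_or_compl hG.compl hx

/-- In a finite cograph, any two distinct vertices `v, w` are contained in a least strong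
module `M`, and `v` and `w` are adjacent iff the subgraph induced by `M` is connected. -/
theorem cograph_least_strong_module_adj_iff_connected {V : Type*} [Fintype V]
    (G : SimpleGraph V) (hp4 : IsP4Free G) (v w : V) (hvw : v ≠ w) :
    ∃ M : Set V, IsStrongModule G M ∧ v ∈ M ∧ w ∈ M ∧
      (∀ M' : Set V, IsStrongModule G M' → v ∈ M' → w ∈ M' → M ⊆ M') ∧
      (G.Adj v w ↔ (G.induce M).Connected) := by
  let S : Set (Set V) := {N | IsStrongModule G N ∧ v ∈ N ∧ w ∈ N}
  have hM : IsStrongModule G (⋂₀ S) := .sInter fun N hN => hN.1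
  have hv : v ∈ ⋂₀ S := fun N hN => hN.2.1
  have hw : w ∈ ⋂₀ S := fun N hN => hN.2.2
  have hleast : ∀ M' : Set V, IsStrongModule G M' → v ∈ M' → w ∈ M' → ⋂₀ S ⊆ M' :=
    fun M' h hv hw => Set.sInter_subset_of_mem ⟨h, hv, hw⟩
  refine ⟨⋂₀ S, hM, hv, hw, hleast, induce_connected_of_least_of_adj hM hv hw hleast, fun hc => ?_⟩
  by_contra hadj
  have hc' : (Gᶜ.induce (⋂₀ S)).Connected :=
    induce_connected_of_least_of_adj (isStrongModule_compl_iff.2 hM) hv hw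
      (fun M' h => hleast M' (isStrongModule_compl_iff.1 h))
      ((SimpleGraph.compl_adj _ _ _).2 ⟨hvw, hadj⟩)
  rcases hp4.hasCut_or_hasCut_compl (Set.toFinite _) ⟨v, hv, w, hw, hvw⟩ with h | h
  · exact h.not_connected hc
  · exact h.not_connected hc'
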